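/- Let f : ℂ → ℂ be smooth (infinitely differentiable over ℝ) with compact support and let m ≥ 1 be a natural number. Write ∂_z^{(j)}f for the j-fold iterate of the Wirtinger derivative ∂/∂z applied to f. Then lim_{ε→0⁺} ∫_{{z : ℂ | ε ≤ ‖z‖}} (∂f/∂z̄)(z)/z^m dA(z) = −(π/(m−1)!) · (∂_z^{(m−1)}f)(0); in particular the limit exists. -/

import Mathlib

open MeasureTheory Filter Topology

/-- The Wirtinger derivative `∂f/∂z` of `f : ℂ → ℂ`, computed from the real Fréchet
derivative. -/
noncomputable def wirtingerDZ (f : ℂ → ℂ) : ℂ → ℂ :=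
  fun z => (1 / 2 : ℂ) * (fderiv ℝ f z 1 - Complex.I * fderiv ℝ f z Complex.I)

/-- The conjugate Wirtinger derivative `∂f/∂z̄` of `f : ℂ → ℂ`, computed from the real
Fréchet derivative. -/
noncomputable def wirtingerDZBar (f : ℂ → ℂ) : ℂ → ℂ :=
  fun z => (1 / 2 : ℂ) * (fderiv ℝ f z 1 + Complex.I * fderiv ℝ f z Complex.I)

lemma wz_decomp (f : ℂ → ℂ) (z v : ℂ) :
    fderiv ℝ f z v = wirtingerDZ f z * v + wirtingerDZBar f z * (starRingEnd ℂ) v := by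
  have h : v = v.re • (1 : ℂ) + v.im • Complex.I := by
    simp [Complex.re_add_im]
  have h2 : fderiv ℝ f z v = v.re • fderiv ℝ f z 1 + v.im • fderiv ℝ f z Complex.I := by
    conv_lhs => rw [h]
    rw [map_add, map_smul, map_smul]
  have h3 : (starRingEnd ℂ) v = v.re - v.im * Complex.I := by
    apply Complex.ext <;> simp
  have h4 : v = v.re + v.im * Complex.I := (Complex.re_add_im v).symm
  rw [h2, h3]
  generalize v.re = a at *
  generalize v.im = b at *
  subst h4
  simp only [wirtingerDZ, wirtingerDZBar, Complex.real_smul]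
  linear_combination (fderiv ℝ f z Complex.I * b) * Complex.I_sq

lemma wz_smooth {f : ℂ → ℂ} (hf : ContDiff ℝ (⊤ : ℕ∞) f) :
    ContDiff ℝ (⊤ : ℕ∞) (wirtingerDZ f) := by
  have h : ContDiff ℝ (⊤ : ℕ∞) (fderiv ℝ f) := hf.fderiv_right (by simp)
  unfold wirtingerDZ
  exact contDiff_const.mul ((h.clm_apply contDiff_const).sub
    (contDiff_const.mul (h.clm_apply contDiff_const)))

lemma wzb_smooth {f : ℂ → ℂ} (hf : ContDiff ℝ (⊤ : ℕ∞) f) :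
    ContDiff ℝ (⊤ : ℕ∞) (wirtingerDZBar f) := by
  have h : ContDiff ℝ (⊤ : ℕ∞) (fderiv ℝ f) := hf.fderiv_right (by simp)
  unfold wirtingerDZBar
  exact contDiff_const.mul ((h.clm_apply contDiff_const).add
    (contDiff_const.mul (h.clm_apply contDiff_const)))

/-- Integrand of the `k`-th Fourier coefficient on the circle of radius `r`. -/
noncomputable def fcI (k : ℤ) (f : ℂ → ℂ) (r θ : ℝ) : ℂ :=
  f (r * Complex.exp (θ * Complex.I)) * Complex.exp (-(k * (θ * Complex.I)))

noncomputable def fc (k : ℤ) (f : ℂ → ℂ) (r : ℝ) : ℂ :=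
  ∫ θ in (-Real.pi)..Real.pi, fcI k f r θ

lemma fcI_cont (k : ℤ) {f : ℂ → ℂ} (hf : Continuous f) :
    Continuous (fun p : ℝ × ℝ => fcI k f p.1 p.2) := by
  unfold fcI; fun_prop

lemma fcI_cont_right (k : ℤ) {f : ℂ → ℂ} (hf : Continuous f) (r : ℝ) :
    Continuous (fcI k f r) := by
  unfold fcI; fun_prop

lemma fc_cont (k : ℤ) {f : ℂ → ℂ} (hf : Continuous f) : Continuous (fc k f) := by
  unfold fc
  exact intervalIntegral.continuous_parametric_intervalIntegral_of_continuous' (fcI_cont k hf) _ _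

lemma exp_conj (θ : ℝ) : (starRingEnd ℂ) (Complex.exp (θ * Complex.I))
    = Complex.exp (-(θ * Complex.I)) := by
  rw [← Complex.exp_conj]; simp

lemma fcI_sub_one (k : ℤ) (g : ℂ → ℂ) (r θ : ℝ) :
    fcI (k - 1) g r θ = g (r * Complex.exp (θ * Complex.I)) * Complex.exp (θ * Complex.I) *
      Complex.exp (-(k * (θ * Complex.I))) := by
  rw [fcI, mul_assoc, ← Complex.exp_add]; push_cast; ring_nf

lemma fcI_add_one (k : ℤ) (g : ℂ → ℂ) (r θ : ℝ) :
    fcI (k + 1) g r θ = g (r * Complex.exp (θ * Complex.I)) * Complex.exp (-(θ * Complex.I)) *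
      Complex.exp (-(k * (θ * Complex.I))) := by
  rw [fcI, mul_assoc, ← Complex.exp_add]; push_cast; ring_nf

lemma fcI_deriv_r (k : ℤ) {f : ℂ → ℂ} (hf : ContDiff ℝ (⊤ : ℕ∞) f) (r θ : ℝ) :
    HasDerivAt (fun r => fcI k f r θ)
      (fcI (k - 1) (wirtingerDZ f) r θ + fcI (k + 1) (wirtingerDZBar f) r θ) r := by
  have hd : HasFDerivAt f (fderiv ℝ f (r * Complex.exp (θ * Complex.I)))
      (r * Complex.exp (θ * Complex.I)) :=
    (hf.differentiable (by simp) _).hasFDerivAt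
  have h1 : HasDerivAt (fun r : ℝ => (r : ℂ) * Complex.exp (θ * Complex.I))
      (1 * Complex.exp (θ * Complex.I)) r :=
    (Complex.ofRealCLM.hasDerivAt (x := r)).mul_const _
  have h2 := (hd.comp_hasDerivAt r h1).mul_const (Complex.exp (-(k * (θ * Complex.I))))
  refine h2.congr_deriv ?_
  rw [one_mul, wz_decomp, exp_conj, fcI_sub_one, fcI_add_one]
  ring

lemma fcI_deriv_θ (k : ℤ) {f : ℂ → ℂ} (hf : ContDiff ℝ (⊤ : ℕ∞) f) (r θ : ℝ) :
    HasDerivAt (fun θ => fcI k f r θ)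
      (Complex.I * r * fcI (k - 1) (wirtingerDZ f) r θ
        - Complex.I * r * fcI (k + 1) (wirtingerDZBar f) r θ - Complex.I * k * fcI k f r θ) θ := by
  have hd : HasFDerivAt f (fderiv ℝ f (r * Complex.exp (θ * Complex.I)))
      (r * Complex.exp (θ * Complex.I)) :=
    (hf.differentiable (by simp) _).hasFDerivAt
  have h0 : HasDerivAt (fun θ : ℝ => (θ : ℂ) * Complex.I) (1 * Complex.I) θ :=
    (Complex.ofRealCLM.hasDerivAt (x := θ)).mul_const _
  have h1 : HasDerivAt (fun θ : ℝ => (r : ℂ) * Complex.exp (θ * Complex.I))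
      (r * (Complex.exp (θ * Complex.I) * (1 * Complex.I))) θ :=
    h0.cexp.const_mul _
  have h3 : HasDerivAt (fun θ : ℝ => Complex.exp (-(k * (θ * Complex.I))))
      (Complex.exp (-(k * (θ * Complex.I))) * (-(k * (1 * Complex.I)))) θ :=
    ((h0.const_mul _).fun_neg).cexp
  have h2 := (hd.comp_hasDerivAt θ h1).mul h3
  refine h2.congr_deriv ?_
  rw [wz_decomp, fcI_sub_one, fcI_add_one, fcI]
  simp only [map_mul, Complex.conj_ofReal, exp_conj, one_mul, Complex.conj_I, Function.comp]
  ring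

lemma fc_deriv (k : ℤ) {f : ℂ → ℂ} (hf : ContDiff ℝ (⊤ : ℕ∞) f) (r : ℝ) :
    HasDerivAt (fc k f) (fc (k - 1) (wirtingerDZ f) r + fc (k + 1) (wirtingerDZBar f) r) r := by
  have c1 := fcI_cont (k-1) (wz_smooth hf).continuous
  have c2 := fcI_cont (k+1) (wzb_smooth hf).continuous
  have d1 := fcI_cont_right (k-1) (wz_smooth hf).continuous
  have d2 := fcI_cont_right (k+1) (wzb_smooth hf).continuous
  obtain ⟨C, hC⟩ := ((isCompact_closedBall r 1).prod
    (isCompact_Icc (a := -Real.pi) (b := Real.pi))).exists_bound_of_continuousOn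
      (c1.add c2).continuousOn
  have key := intervalIntegral.hasDerivAt_integral_of_dominated_loc_of_deriv_le
    (μ := volume) (a := -Real.pi) (b := Real.pi) (F := fcI k f)
    (F' := fun r θ => fcI (k - 1) (wirtingerDZ f) r θ + fcI (k + 1) (wirtingerDZBar f) r θ)
    (x₀ := r) (s := Metric.closedBall r 1) (bound := fun _ => C)
    (Metric.closedBall_mem_nhds r one_pos)
    (Eventually.of_forall fun x => (fcI_cont_right k hf.continuous x).aestronglyMeasurable)
    ((fcI_cont_right k hf.continuous r).intervalIntegrable _ _)
    ((d1 r).add (d2 r)).aestronglyMeasurable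
    (Eventually.of_forall fun t ht x hx => by
      rw [Set.uIoc_of_le (by linarith [Real.pi_pos])] at ht
      exact hC (x, t) ⟨hx, ht.1.le, ht.2⟩)
    intervalIntegrable_const
    (Eventually.of_forall fun t ht x hx => fcI_deriv_r k hf x t)
  have := key.2
  rw [intervalIntegral.integral_add ((d1 r).intervalIntegrable _ _)
    ((d2 r).intervalIntegrable _ _)] at this
  exact this

lemma fc_parts (k : ℤ) {f : ℂ → ℂ} (hf : ContDiff ℝ (⊤ : ℕ∞) f) (r : ℝ) :
    r * fc (k - 1) (wirtingerDZ f) r - r * fc (k + 1) (wirtingerDZBar f) r = k * fc k f r := by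
  have d0 := fcI_cont_right k hf.continuous r
  have d1 := fcI_cont_right (k-1) (wz_smooth hf).continuous r
  have d2 := fcI_cont_right (k+1) (wzb_smooth hf).continuous r
  have h := intervalIntegral.integral_eq_sub_of_hasDerivAt (a := -Real.pi) (b := Real.pi)
    (fun θ _ => fcI_deriv_θ k hf r θ) (Continuous.intervalIntegrable (by fun_prop) _ _)
  have hper : fcI k f r Real.pi = fcI k f r (-Real.pi) := by
    have e1 : Complex.exp ((-Real.pi : ℝ) * Complex.I) = Complex.exp (Real.pi * Complex.I) := by
      rw [Complex.exp_eq_exp_iff_exists_int]; exact ⟨-1, by push_cast; ring⟩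
    have e2 : Complex.exp (-(k * ((-Real.pi : ℝ) * Complex.I)))
        = Complex.exp (-(k * (Real.pi * Complex.I))) := by
      rw [Complex.exp_eq_exp_iff_exists_int]; exact ⟨k, by push_cast; ring⟩
    rw [fcI, fcI, e1, e2]
  rw [hper, sub_self, intervalIntegral.integral_sub, intervalIntegral.integral_sub,
    intervalIntegral.integral_const_mul, intervalIntegral.integral_const_mul,
    intervalIntegral.integral_const_mul] at h
  · change Complex.I * r * fc _ _ _ - Complex.I * r * fc _ _ _ - Complex.I * k * fc _ _ _ = 0 at h
    apply mul_left_cancel₀ Complex.I_ne_zero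
    linear_combination h
  all_goals exact Continuous.intervalIntegrable (by fun_prop) _ _

lemma deriv_mul_pow (k : ℕ) {f : ℂ → ℂ} (hf : ContDiff ℝ (⊤ : ℕ∞) f) (r : ℝ) :
    HasDerivAt (fun r : ℝ => (r : ℂ) ^ (k + 1) * fc (k + 1) f r)
      (2 * (r : ℂ) ^ (k + 1) * fc k (wirtingerDZ f) r) r := by
  have h1 := ((Complex.ofRealCLM.hasDerivAt (x := r)).pow (k + 1)).mul (fc_deriv (k+1) hf r)
  have hp := fc_parts (k+1) hf r
  refine h1.congr_deriv ?_
  simp only [Complex.ofRealCLM_apply, add_tsub_cancel_right, Pi.pow_apply] at *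
  push_cast at *
  simp only [add_sub_cancel_right, mul_one] at *
  rw [pow_succ]
  linear_combination (-(r:ℂ)^k) * hp

lemma deriv_div_pow (k : ℕ) {f : ℂ → ℂ} (hf : ContDiff ℝ (⊤ : ℕ∞) f) (r : ℝ) (hr : r ≠ 0) :
    HasDerivAt (fun r : ℝ => fc k f r / (r : ℂ) ^ k)
      (2 * (fc (k + 1) (wirtingerDZBar f) r / (r : ℂ) ^ k)) r := by
  have hr' : (r : ℂ) ≠ 0 := by exact_mod_cast hr
  have h1 := (fc_deriv k hf r).div ((Complex.ofRealCLM.hasDerivAt (x := r)).pow k)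
    (by simpa using fun h => absurd h hr)
  have hp := fc_parts k hf r
  refine h1.congr_deriv ?_
  simp only [Complex.ofRealCLM_apply, Pi.pow_apply, Complex.ofReal_one, mul_one] at *
  push_cast at *
  rw [div_eq_iff (by positivity)]
  rcases k with _ | k
  · simp at *
    have hp2 := sub_eq_zero.1 hp
    have := mul_left_cancel₀ (Complex.ofReal_ne_zero.2 hr') hp2
    simp [this]; ring
  · simp only [add_tsub_cancel_right]
    field_simp
    push_cast at *
    linear_combination ((r:ℂ)^k) * hp

lemma lhop {G G' : ℝ → ℂ} {L : ℂ} (n : ℕ) (hn : 0 < n) (hG : ∀ r > 0, HasDerivAt G (G' r) r)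
    (h0 : Tendsto G (𝓝[>] 0) (𝓝 0))
    (hL : Tendsto (fun r : ℝ => G' r / ((n * r ^ (n - 1) : ℝ) : ℂ)) (𝓝[>] 0) (𝓝 L)) :
    Tendsto (fun r : ℝ => G r / ((r ^ n : ℝ) : ℂ)) (𝓝[>] 0) (𝓝 L) := by
  have gen : ∀ T : ℂ →L[ℝ] ℝ, Tendsto (fun r : ℝ => T (G r / ((r ^ n : ℝ) : ℂ))) (𝓝[>] 0)
      (𝓝 (T L)) := by
    intro T
    have hT : ∀ (z : ℂ) (x : ℝ), T (z / x) = T z / x := by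
      intro z x
      have : z / x = x⁻¹ • z := by
        rw [Complex.real_smul]; push_cast; field_simp
      rw [this, map_smul, smul_eq_mul]; field_simp
    have hev : ∀ᶠ r : ℝ in 𝓝[>] 0, 0 < r := self_mem_nhdsWithin
    simp_rw [hT]
    refine HasDerivAt.lhopital_zero_nhdsGT (f' := fun r => T (G' r))
      (g' := fun r : ℝ => (n * r ^ (n - 1) : ℝ)) ?_ ?_ ?_ ?_ ?_ ?_
    · filter_upwards [hev] with r hr
      exact T.hasFDerivAt.comp_hasDerivAt r (hG r hr)
    · exact Eventually.of_forall fun r => hasDerivAt_pow n r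
    · filter_upwards [hev] with r hr
      positivity
    · simpa [Function.comp_def] using (T.continuous.tendsto 0).comp h0
    · have : Tendsto (fun r : ℝ => r ^ n) (𝓝 0) (𝓝 (0 ^ n)) := (continuous_pow n).tendsto 0
      rw [zero_pow hn.ne'] at this
      exact this.mono_left nhdsWithin_le_nhds
    · have := (T.continuous.tendsto L).comp hL
      simpa only [Function.comp_def, hT] using this
  have h1 := gen Complex.reCLM
  have h2 := gen Complex.imCLM
  have h3 := (((Complex.continuous_ofReal.tendsto _).comp h1).add
    (((Complex.continuous_ofReal.tendsto _).comp h2).mul_const Complex.I))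
  simpa only [Function.comp_def, Complex.reCLM_apply, Complex.imCLM_apply, Complex.re_add_im]
    using h3

lemma fc_lim (k : ℕ) : ∀ {f : ℂ → ℂ}, ContDiff ℝ (⊤ : ℕ∞) f →
    Tendsto (fun r : ℝ => fc k f r / (r : ℂ) ^ k) (𝓝[>] 0)
      (𝓝 (2 * Real.pi / (Nat.factorial k : ℂ) * (wirtingerDZ^[k] f) 0)) := by
  induction k with
  | zero =>
    intro f hf
    have h := ((fc_cont 0 hf.continuous).tendsto 0).mono_left
      (nhdsWithin_le_nhds (s := Set.Ioi 0))
    have h2 : fc 0 f 0 = 2 * Real.pi * f 0 := by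
      simp [fc, fcI]; left; ring
    simpa [h2] using h
  | succ k ih =>
    intro f hf
    have ih' := ih (wz_smooth hf)
    have hev : ∀ᶠ r : ℝ in 𝓝[>] 0, 0 < r := self_mem_nhdsWithin
    have h0 : Tendsto (fun r : ℝ => (r : ℂ) ^ (k + 1) * fc (k + 1) f r) (𝓝[>] 0) (𝓝 0) := by
      have hc : Continuous (fun r : ℝ => (r : ℂ) ^ (k + 1) * fc (k + 1) f r) :=
        (Complex.continuous_ofReal.pow _).mul (fc_cont _ hf.continuous)
      simpa using (hc.tendsto 0).mono_left (nhdsWithin_le_nhds (s := Set.Ioi 0))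
    have key := lhop (L := 2 * Real.pi / (Nat.factorial (k+1) : ℂ) * (wirtingerDZ^[k+1] f) 0)
      (2 * (k + 1)) (by omega) (fun r _ => deriv_mul_pow k hf r) h0 ?_
    · refine key.congr' ?_
      filter_upwards [hev] with r hr
      have hr' : (r : ℂ) ≠ 0 := by exact_mod_cast hr.ne'
      push_cast
      rw [div_eq_div_iff (by positivity) (by positivity)]
      ring
    · have := ih'.div_const ((k : ℂ) + 1)
      have hk : (k : ℂ) + 1 ≠ 0 := by exact_mod_cast Nat.succ_ne_zero k
      have hk2 : (Nat.factorial k : ℂ) ≠ 0 := by exact_mod_cast Nat.factorial_ne_zero k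
      have e : 2 * (Real.pi : ℂ) / (Nat.factorial (k+1) : ℂ) * (wirtingerDZ^[k+1] f) 0 =
          2 * Real.pi / (Nat.factorial k : ℂ) * (wirtingerDZ^[k] (wirtingerDZ f)) 0 / (k + 1) := by
        rw [Function.iterate_succ_apply, Nat.factorial_succ]
        push_cast
        field_simp
      rw [e]
      refine this.congr' ?_
      filter_upwards [hev] with r hr
      have hr' : (r : ℂ) ≠ 0 := by exact_mod_cast hr.ne'
      have : 2 * (k + 1) - 1 = (k + 1) + k := by omega
      rw [this]
      push_cast
      field_simp
      ring

lemma area_eq {g : ℂ → ℂ} (hg : Continuous g) {R : ℝ} (hR : ∀ z, R ≤ ‖z‖ → g z = 0)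
    (m : ℕ) {ε : ℝ} (hε : 0 < ε) (hεR : ε ≤ R) :
    ∫ z in {z : ℂ | ε ≤ ‖z‖}, g z / z ^ (m + 1)
      = ∫ r in ε..R, fc (m + 1) g r / (r : ℂ) ^ m := by
  have hms : MeasurableSet {z : ℂ | ε ≤ ‖z‖} := measurableSet_le measurable_const measurable_norm
  rw [← integral_indicator hms, ← Complex.integral_comp_polarCoord_symm]
  have hpt : ∀ r θ : ℝ, 0 < r → Complex.polarCoord.symm (r, θ)
      = r * Complex.exp (θ * Complex.I) := by
    intro r θ _
    rw [Complex.polarCoord_symm_apply, Complex.exp_mul_I]; simp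
  have hmt : MeasurableSet (Set.Icc ε R ×ˢ Set.Ioo (-Real.pi) Real.pi) :=
    measurableSet_Icc.prod measurableSet_Ioo
  have step1 : ∫ p in polarCoord.target, p.1 • ({z : ℂ | ε ≤ ‖z‖}.indicator
        (fun z => g z / z ^ (m + 1))) (Complex.polarCoord.symm p)
      = ∫ p in Set.Icc ε R ×ˢ Set.Ioo (-Real.pi) Real.pi,
          fcI (m + 1) g p.1 p.2 / (p.1 : ℂ) ^ m := by
    have hsub : Set.Icc ε R ×ˢ Set.Ioo (-Real.pi) Real.pi ⊆ polarCoord.target := by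
      rintro ⟨r, θ⟩ ⟨h1, h2⟩
      exact ⟨lt_of_lt_of_le hε h1.1, h2⟩
    rw [setIntegral_eq_of_subset_of_forall_sdiff_eq_zero
      (polarCoord.open_target.measurableSet) hsub]
    · refine setIntegral_congr_fun hmt ?_
      rintro ⟨r, θ⟩ ⟨h1, h2⟩
      have hr : 0 < r := lt_of_lt_of_le hε h1.1
      have hr' : (r : ℂ) ≠ 0 := by exact_mod_cast hr.ne'
      have hmem : (r : ℂ) * Complex.exp (θ * Complex.I) ∈ {z : ℂ | ε ≤ ‖z‖} := by
        simpa [Complex.norm_exp_ofReal_mul_I, abs_of_pos hr] using h1.1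
      have hexp : Complex.exp (-(((m:ℤ) + 1 : ℤ) * (θ * Complex.I)))
          = (Complex.exp (θ * Complex.I) ^ (m + 1))⁻¹ := by
        rw [Complex.exp_neg, ← Complex.exp_nat_mul]; push_cast; rfl
      simp only
      rw [hpt r θ hr, Set.indicator_of_mem hmem, fcI, hexp, Complex.real_smul]
      have := Complex.exp_ne_zero (θ * Complex.I)
      field_simp
      ring
    · rintro ⟨r, θ⟩ ⟨h1, h2⟩
      have hr : 0 < r := h1.1
      simp only
      rw [hpt r θ hr]
      have hn : ‖(r : ℂ) * Complex.exp (θ * Complex.I)‖ = r := by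
        simp [Complex.norm_exp_ofReal_mul_I, abs_of_pos hr]
      by_cases hr2 : ε ≤ r
      · have : R ≤ r := by
          by_contra hcon
          exact h2 ⟨⟨hr2, (not_le.1 hcon).le⟩, h1.2⟩
        have hz := hR ((r : ℂ) * Complex.exp (θ * Complex.I)) (by rw [hn]; exact this)
        simp [Set.indicator_apply, hz]
      · rw [Set.indicator_of_notMem, smul_zero]
        rw [Set.mem_setOf_eq, hn]; exact hr2
  rw [step1]
  have hint : IntegrableOn (fun p : ℝ × ℝ => fcI (m + 1) g p.1 p.2 / (p.1 : ℂ) ^ m)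
      (Set.Icc ε R ×ˢ Set.Ioo (-Real.pi) Real.pi) (volume.prod volume) := by
    have : IntegrableOn (fun p : ℝ × ℝ => fcI (m + 1) g p.1 p.2 / (p.1 : ℂ) ^ m)
      (Set.Icc ε R ×ˢ Set.Icc (-Real.pi) Real.pi) (volume.prod volume) := by
      refine ContinuousOn.integrableOn_compact (isCompact_Icc.prod isCompact_Icc) ?_
      refine (fcI_cont _ hg).continuousOn.div (by fun_prop) ?_
      rintro ⟨r, θ⟩ ⟨h1, h2⟩
      have hr : 0 < r := lt_of_lt_of_le hε h1.1
      have hr' : (r : ℂ) ≠ 0 := by exact_mod_cast hr.ne'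
      exact pow_ne_zero _ hr'
    exact this.mono_set (Set.prod_mono le_rfl Set.Ioo_subset_Icc_self)
  rw [Measure.volume_eq_prod, setIntegral_prod _ hint, integral_Icc_eq_integral_Ioc,
    ← intervalIntegral.integral_of_le hεR]
  congr 1
  funext r
  simp only
  rw [integral_div, ← integral_Ioc_eq_integral_Ioo,
    ← intervalIntegral.integral_of_le (by linarith [Real.pi_pos])]
  rfl

/-- For `f : ℂ → ℂ` smooth with compact support and `m ≥ 1`, the radial
principal value of `(∂f/∂z̄)(z)/z^m` exists and equals `-(π/(m-1)!) · (∂_z^{(m-1)} f)(0)`. -/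
theorem stmt_8 (f : ℂ → ℂ) (hf : ContDiff ℝ (⊤ : ℕ∞) f) (hfc : HasCompactSupport f)
    (m : ℕ) (hm : 1 ≤ m) :
    Tendsto (fun ε : ℝ => ∫ z in {z : ℂ | ε ≤ ‖z‖}, wirtingerDZBar f z / z ^ m)
      (𝓝[>] (0 : ℝ))
      (𝓝 (-((Real.pi : ℂ) / (Nat.factorial (m - 1) : ℂ)) * (wirtingerDZ^[m - 1] f) 0)) := by
  obtain ⟨k, rfl⟩ : ∃ k, m = k + 1 := ⟨m - 1, by omega⟩
  rw [add_tsub_cancel_right]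
  obtain ⟨R₀, hR₀⟩ := hfc.isCompact.isBounded.subset_ball (0 : ℂ)
  set R := max R₀ 1 with hRdef
  have hRpos : 0 < R := lt_of_lt_of_le one_pos (le_max_right _ _)
  have hnot : ∀ z : ℂ, R ≤ ‖z‖ → z ∉ tsupport f := by
    intro z hz hmem
    have := hR₀ hmem
    rw [mem_ball_zero_iff] at this
    linarith [le_max_left R₀ 1]
  have hfR : ∀ z : ℂ, R ≤ ‖z‖ → f z = 0 := fun z hz => image_eq_zero_of_notMem_tsupport (hnot z hz)
  have hgR : ∀ z : ℂ, R ≤ ‖z‖ → wirtingerDZBar f z = 0 := by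
    intro z hz
    simp [wirtingerDZBar, fderiv_of_notMem_tsupport ℝ (hnot z hz)]
  have hlim := (fc_lim k hf).const_mul (-(1 / 2 : ℂ))
  have e : -((Real.pi : ℂ) / (Nat.factorial k : ℂ)) * (wirtingerDZ^[k] f) 0 =
      -(1 / 2 : ℂ) * (2 * Real.pi / (Nat.factorial k : ℂ) * (wirtingerDZ^[k] f) 0) := by ring
  rw [e]
  refine hlim.congr' ?_
  have hev : ∀ᶠ r : ℝ in 𝓝[>] 0, r ∈ Set.Ioo 0 R := Ioo_mem_nhdsGT hRpos
  filter_upwards [hev] with ε hε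
  have hgc := (wzb_smooth hf).continuous
  rw [area_eq hgc hgR k hε.1 hε.2.le]
  have hpos : ∀ r ∈ Set.uIcc ε R, 0 < r := by
    intro r hr
    rw [Set.uIcc_of_le hε.2.le] at hr
    exact lt_of_lt_of_le hε.1 hr.1
  have hcont : ContinuousOn (fun r : ℝ => 2 * (fc (k + 1) (wirtingerDZBar f) r / (r : ℂ) ^ k))
      (Set.uIcc ε R) := by
    refine continuousOn_const.mul ((fc_cont _ hgc).continuousOn.div (by fun_prop) ?_)
    intro r hr
    have hr' : (r : ℂ) ≠ 0 := by exact_mod_cast (hpos r hr).ne'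
    exact pow_ne_zero _ hr'
  have h := intervalIntegral.integral_eq_sub_of_hasDerivAt (a := ε) (b := R)
    (fun r hr => deriv_div_pow k hf r (hpos r hr).ne') hcont.intervalIntegrable
  have hz : fc k f R = 0 := by
    have : ∀ θ, fcI k f R θ = 0 := by
      intro θ
      rw [fcI, hfR, zero_mul]
      simp [Complex.norm_exp_ofReal_mul_I, abs_of_pos hRpos]
    simp [fc, this]
  rw [intervalIntegral.integral_const_mul, hz, zero_div] at h
  linear_combination (-1 / 2 : ℂ) * h
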